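/- arXiv:2509.08692 — 3 statements merged into one kernel-verified Lean document; each statement's English description precedes it below -/
import Mathlib

section
/- For every integer k ≥ 2, every oriented linear k-graph with Property O has at least (k!)²/(2e²k⁴) edges; that is, f'(k) ≥ (k!)²/(2e²k⁴). -/
open Finset in
open scoped Classical in
/-- Symmetric (lopsided) local lemma, counting form. -/
theorem lll_aux {Ω ι : Type*} [Fintype Ω] [Nonempty Ω] (A : ι → Ω → Prop) (Γ : ι → Finset ι)
    (E : Finset ι) (d : ℕ) (p x : ℝ) (hx0 : 0 ≤ x) (hx1 : x < 1) (hp : p ≤ x * (1 - x) ^ d)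
    (hd : ∀ i ∈ E, (Γ i).card ≤ d)
    (hind : ∀ i ∈ E, ∀ S ⊆ E, (∀ j ∈ S, j ∉ Γ i ∧ j ≠ i) →
      ((univ.filter fun ω => A i ω ∧ ∀ j ∈ S, ¬ A j ω).card : ℝ) ≤
        p * ((univ.filter fun ω => ∀ j ∈ S, ¬ A j ω).card : ℝ)) :
    ∃ ω, ∀ i ∈ E, ¬ A i ω := by
  set N : Finset ι → ℝ := fun S => ((univ.filter fun ω => ∀ j ∈ S, ¬ A j ω).card : ℝ) with hN
  have hN0 : ∀ S, 0 ≤ N S := fun S => Nat.cast_nonneg _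
  have chain : ∀ n : ℕ, (∀ S ⊆ E, S.card < n → ∀ i ∈ E, i ∉ S →
        (1 - x) * N S ≤ N (insert i S)) →
      ∀ S2 ⊆ E, ∀ T : Finset ι, T ⊆ E → Disjoint T S2 → T.card + S2.card ≤ n →
        (1 - x) ^ T.card * N S2 ≤ N (T ∪ S2) := by
    intro n hn S2 hS2 T
    induction T using Finset.induction_on with
    | empty => intro _ _ _; simp
    | insert a T ha ih =>
      intro hTE hdis hcard
      rw [card_insert_of_notMem ha] at hcard ⊢
      rw [disjoint_insert_left] at hdis
      have hTE' : T ⊆ E := fun y hy => hTE (mem_insert_of_mem hy)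
      have h1 := ih hTE' hdis.2 (by omega)
      have h2 := hn (T ∪ S2) (union_subset hTE' hS2)
        (by have := card_union_le T S2; omega) a (hTE (mem_insert_self _ _))
        (by simp [ha, hdis.1])
      rw [insert_union]
      refine le_trans ?_ h2
      rw [pow_succ', mul_assoc]
      exact mul_le_mul_of_nonneg_left h1 (by linarith)
  have key : ∀ n : ℕ, ∀ S ⊆ E, S.card = n → ∀ i ∈ E, i ∉ S →
        (1 - x) * N S ≤ N (insert i S) := by
    intro n
    induction n using Nat.strong_induction_on with
    | _ n ih =>
      intro S hS hcard i hi hiS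
      have hch := chain n (fun S hS hlt => ih S.card hlt S hS rfl)
        (S \ Γ i) (sdiff_subset.trans hS) (S ∩ Γ i) (inter_subset_left.trans hS)
        (by
          rw [Finset.disjoint_left]; intro a ha hb
          simp only [mem_inter, mem_sdiff] at ha hb
          exact hb.2 ha.2)
        (by rw [← hcard]; exact (card_inter_add_card_sdiff S (Γ i)).le)
      have hU : (S ∩ Γ i) ∪ (S \ Γ i) = S := by
        ext a; simp only [mem_union, mem_inter, mem_sdiff]; tauto
      rw [hU] at hch
      have hpow : (1 - x) ^ d ≤ (1 - x) ^ (S ∩ Γ i).card :=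
        pow_le_pow_of_le_one (by linarith) (by linarith)
          ((card_le_card inter_subset_right).trans (hd i hi))
      have h1 := hind i hi (S \ Γ i) (sdiff_subset.trans hS) (by
        intro j hj
        rw [mem_sdiff] at hj
        exact ⟨hj.2, fun h => hiS (h ▸ hj.1)⟩)
      have h2 : ((univ.filter fun ω => A i ω ∧ ∀ j ∈ S, ¬ A j ω).card : ℝ) ≤
          ((univ.filter fun ω => A i ω ∧ ∀ j ∈ S \ Γ i, ¬ A j ω).card : ℝ) := by
        norm_cast
        apply card_le_card
        intro ω
        simp only [mem_filter, mem_univ, true_and, mem_sdiff]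
        exact fun h => ⟨h.1, fun j hj => h.2 j hj.1⟩
      have h3 : N S = ((univ.filter fun ω => A i ω ∧ ∀ j ∈ S, ¬ A j ω).card : ℝ)
          + N (insert i S) := by
        simp only [hN]
        norm_cast
        rw [← card_filter_add_card_filter_not (s := univ.filter fun ω => ∀ j ∈ S, ¬ A j ω)
          (fun ω => A i ω), filter_filter, filter_filter]
        congr 2
        · ext ω; simp only [mem_filter, mem_univ, true_and]; tauto
        · ext ω; simp only [mem_filter, mem_univ, true_and, mem_insert, forall_eq_or_imp]; tauto
      have h4 : p * N (S \ Γ i) ≤ x * N S := by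
        calc p * N (S \ Γ i) ≤ (x * (1 - x) ^ d) * N (S \ Γ i) :=
              mul_le_mul_of_nonneg_right hp (hN0 _)
          _ = x * ((1 - x) ^ d * N (S \ Γ i)) := by ring
          _ ≤ x * ((1 - x) ^ (S ∩ Γ i).card * N (S \ Γ i)) :=
              mul_le_mul_of_nonneg_left (mul_le_mul_of_nonneg_right hpow (hN0 _)) hx0
          _ ≤ x * N S := mul_le_mul_of_nonneg_left hch hx0
      have h5 := h2.trans (h1.trans h4)
      linarith
  have hfin := chain E.card (fun S hS _ => key _ S hS rfl) ∅ (empty_subset _) E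
    (Subset.refl _) (disjoint_empty_right _) (by simp)
  have hpos : 0 < N E := by
    rw [union_empty] at hfin
    refine lt_of_lt_of_le ?_ hfin
    apply mul_pos (pow_pos (by linarith) _)
    simp [hN, Fintype.card_pos]
  simp only [hN] at hpos
  norm_cast at hpos
  obtain ⟨ω, hω⟩ := card_pos.mp hpos
  exact ⟨ω, by simpa using hω⟩

/-- Parameter choice in the local lemma. -/
theorem lll_param (d : ℕ) (p : ℝ) (hp : Real.exp 1 * p * (d + 1) ≤ 1) :
    ∃ x : ℝ, 0 ≤ x ∧ x < 1 ∧ p ≤ x * (1 - x) ^ d := by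
  have he : (2 : ℝ) ≤ Real.exp 1 := by have := Real.add_one_le_exp (1 : ℝ); linarith
  rcases Nat.eq_zero_or_pos d with rfl | hd
  · refine ⟨1 / 2, by norm_num, by norm_num, ?_⟩
    norm_num at hp ⊢
    by_contra h
    push Not at h
    nlinarith
  · have hd' : (0 : ℝ) < d := by exact_mod_cast hd
    refine ⟨1 / (d + 1), by positivity, ?_, ?_⟩
    · rw [div_lt_one (by positivity)]; linarith
    · have h1 : (1 - 1 / ((d : ℝ) + 1)) = (((d : ℝ) + 1) / d)⁻¹ := by field_simp; ring
      have h2 : (((d : ℝ) + 1) / d) ^ d ≤ Real.exp 1 := by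
        have h := Real.add_one_le_exp (1 / (d : ℝ))
        calc (((d : ℝ) + 1) / d) ^ d ≤ (Real.exp (1 / d)) ^ d := by
              apply pow_le_pow_left₀ (by positivity)
              have : ((d : ℝ) + 1) / d = 1 / d + 1 := by field_simp; ring
              linarith
          _ = Real.exp 1 := by
              rw [← Real.exp_nat_mul]; congr 1; field_simp
      rw [h1, inv_pow]
      have h3 : (Real.exp 1)⁻¹ ≤ ((((d : ℝ) + 1) / d) ^ d)⁻¹ :=
        inv_anti₀ (by positivity) h2
      have h4 : p ≤ 1 / (d + 1) * (Real.exp 1)⁻¹ := by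
        rw [← div_eq_mul_inv, div_div, le_div_iff₀ (by positivity)]
        linarith
      exact h4.trans (mul_le_mul_of_nonneg_left h3 (by positivity))

open Finset in
open scoped Classical in
/-- Independence of the order inside a tuple from the events outside it. -/
theorem order_indep {V : Type*} [Fintype V] {n m : ℕ} (g : Fin m → V)
    (hg : Function.Injective g) (T : (V ≃ Fin n) → Prop)
    (hT : ∀ σ τ : V ≃ Fin n, (∀ v, v ∉ Set.range g → σ v = τ v) → T σ → T τ) :
    (univ.filter fun σ : V ≃ Fin n => StrictMono (σ ∘ g) ∧ T σ).card * m.factorial ≤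
      (univ.filter fun σ : V ≃ Fin n => T σ).card := by
  have hc : (univ : Finset (Equiv.Perm (Fin m))).card = m.factorial := by
    rw [card_univ, Fintype.card_perm, Fintype.card_fin]
  rw [← hc, ← card_product]
  set ι : Fin m ↪ V := ⟨g, hg⟩ with hι
  have happ : ∀ (π : Equiv.Perm (Fin m)) i, (π.viaEmbedding ι) (g i) = g (π i) :=
    fun π i => Equiv.Perm.viaEmbedding_apply π ι i
  apply card_le_card_of_injOn (fun q => (q.2.viaEmbedding ι).trans q.1)
  · rintro ⟨σ, π⟩ h
    simp only [coe_product, Set.mem_prod, mem_coe, mem_filter, mem_univ, true_and, and_true]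
      at h ⊢
    refine hT σ _ ?_ h.2
    intro v hv
    rw [Equiv.trans_apply, Equiv.Perm.viaEmbedding_apply_of_notMem]
    exact hv
  · rintro ⟨σ, π⟩ h ⟨σ', π'⟩ h' heq
    simp only [coe_product, Set.mem_prod, mem_coe, mem_filter, mem_univ, true_and, and_true]
      at h h' heq
    have hi : ∀ i, σ (g (π i)) = σ' (g (π' i)) := by
      intro i
      have := DFunLike.congr_fun heq (g i)
      simpa only [Equiv.trans_apply, happ] using this
    have hr : σ ∘ g = σ' ∘ g := by
      rw [← StrictMono.range_inj h.1 h'.1]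
      have e1 : Set.range (σ ∘ g) = Set.range ((σ ∘ g) ∘ π) := by
        rw [π.surjective.range_comp]
      have e2 : Set.range (σ' ∘ g) = Set.range ((σ' ∘ g) ∘ π') := by
        rw [π'.surjective.range_comp]
      rw [e1, e2]
      congr 1
      funext i
      exact hi i
    have hpi : π = π' := by
      ext1 i
      have h1 := hi i
      have h2 : σ (g (π i)) = σ' (g (π i)) := congrFun hr (π i)
      rw [h2] at h1
      exact hg (σ'.injective h1)
    subst hpi
    have : σ = σ' := by
      ext1 v
      have := DFunLike.congr_fun heq ((π.viaEmbedding ι).symm v)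
      simpa using this
    rw [this]

open Finset in
open scoped Classical in
/-- Many vertices of large degree in a linear family force many edges. -/
theorem many_edges {V ε : Type*} (E : Finset ε) (I : V → ε → Prop) (t : ℕ)
    (hlin : ∀ e ∈ E, ∀ f ∈ E, e ≠ f → ∀ v w, I v e → I v f → I w e → I w f → v = w) :
    ∀ W : Finset V, (∀ w ∈ W, t ≤ (E.filter (I w)).card) →
      W.card * t ≤ (E.filter fun e => ∃ w ∈ W, I w e).card + W.card.choose 2 := by
  intro W
  induction W using Finset.induction_on with
  | empty => simp
  | insert a W ha ih =>
    intro h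
    have ih' := ih fun w hw => h w (mem_insert_of_mem hw)
    have hA := h a (mem_insert_self _ _)
    rw [card_insert_of_notMem ha, Nat.choose_succ_succ' W.card 1, Nat.choose_one_right]
    have hU : (E.filter fun e => ∃ w ∈ insert a W, I w e) =
        (E.filter (I a)) ∪ (E.filter fun e => ∃ w ∈ W, I w e) := by
      ext e; simp only [mem_filter, mem_union, mem_insert, exists_eq_or_imp]; tauto
    have hI : ((E.filter (I a)) ∩ (E.filter fun e => ∃ w ∈ W, I w e)).card ≤ W.card := by
      have hex : ∀ e ∈ (E.filter (I a)) ∩ (E.filter fun e => ∃ w ∈ W, I w e),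
          ∃ w ∈ W, I w e := fun e he => (mem_filter.mp (mem_inter.mp he).2).2
      have : Nonempty V := ⟨a⟩
      choose! φ hφ using hex
      apply card_le_card_of_injOn φ
      · intro e he; exact (hφ e he).1
      · intro e he f hf hef
        by_contra hne
        have he' := mem_filter.mp (mem_inter.mp he).1
        have hf' := mem_filter.mp (mem_inter.mp hf).1
        have := hlin e he'.1 f hf'.1 hne a (φ e) he'.2 hf'.2 (hφ e he).2
          (hef ▸ (hφ f hf).2)
        exact ha (this ▸ (hφ e he).1)
    have := card_union_add_card_inter (E.filter (I a)) (E.filter fun e => ∃ w ∈ W, I w e)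
    rw [hU]
    nlinarith

open scoped Classical in
theorem many_edges' {V ε : Type*} (E : Finset ε) (I : V → ε → Prop) (t : ℕ)
    (hlin : ∀ e ∈ E, ∀ f ∈ E, e ≠ f → ∀ v w, I v e → I v f → I w e → I w f → v = w)
    (W : Finset V) (hW : ∀ w ∈ W, t ≤ (E.filter (I w)).card) :
    W.card * t ≤ E.card + W.card.choose 2 :=
  (many_edges E I t hlin W hW).trans (Nat.add_le_add_right (Finset.card_filter_le _ _) _)

/-- For every integer `k ≥ 2`, every oriented linear `k`-graph with
Property O has at least `(k!)² / (2e²k⁴)` edges.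

An oriented `k`-graph is given by a finite vertex type `V` and a finite set `E` of
injective tuples `Fin k → V`, no two of which have the same underlying set.
It is linear if any two distinct edges meet in at most one vertex.
A linear order on `V` is encoded by an injective map `σ : V → ℕ`; an edge `e` is
consistent with `σ` if `σ (e i) < σ (e j)` whenever `i < j`. -/
theorem stmt_0 (k : ℕ) (hk : 2 ≤ k) (V : Type*) [Fintype V]
    (E : Finset (Fin k → V))
    (hinj : ∀ e ∈ E, Function.Injective e)
    (hdist : ∀ e ∈ E, ∀ f ∈ E, Set.range e = Set.range f → e = f)
    (hlin : ∀ e ∈ E, ∀ f ∈ E, e ≠ f → (Set.range e ∩ Set.range f).Subsingleton)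
    (hO : ∀ σ : V → ℕ, Function.Injective σ →
      ∃ e ∈ E, ∀ i j : Fin k, i < j → σ (e i) < σ (e j)) :
    ((Nat.factorial k : ℝ)) ^ 2 / (2 * Real.exp 1 ^ 2 * (k : ℝ) ^ 4) ≤ E.card := by
  classical
  obtain ⟨m, rfl⟩ : ∃ m, k = m + 1 := ⟨k - 1, by omega⟩
  have hm : 1 ≤ m := by omega
  set deg : V → ℕ := fun v => (E.filter fun e => v ∈ Set.range e).card with hdeg
  have hmax : ∀ e : Fin (m + 1) → V, ∃ a, ∀ i, deg (e i) ≤ deg (e a) := by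
    intro e
    obtain ⟨a, -, ha⟩ := Finset.exists_max_image Finset.univ (fun i => deg (e i))
      ⟨0, Finset.mem_univ _⟩
    exact ⟨a, fun i => ha i (Finset.mem_univ _)⟩
  choose a ha using hmax
  set g : (Fin (m + 1) → V) → Fin m → V := fun e => e ∘ (a e).succAbove with hg
  have hginj : ∀ e ∈ E, Function.Injective (g e) := fun e he =>
    (hinj e he).comp Fin.succAbove_right_injective
  have hgr : ∀ e, Set.range (g e) ⊆ Set.range e := fun e => Set.range_comp_subset_range _ _
  -- neighbourhoods
  set Γ : (Fin (m + 1) → V) → Finset (Fin (m + 1) → V) := fun e =>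
    E.filter fun f => f ≠ e ∧ ∃ v, v ∈ Set.range (g e) ∧ v ∈ Set.range (g f) with hΓ
  have hEne : E.Nonempty := by
    obtain ⟨e, he, -⟩ := hO (fun v => (Fintype.equivFin V v : ℕ))
      (Fin.val_injective.comp (Fintype.equivFin V).injective)
    exact ⟨e, he⟩
  obtain ⟨e₀, he₀, hmax₀⟩ := Finset.exists_max_image E (fun e => (Γ e).card) hEne
  set d := (Γ e₀).card with hd
  have hfpos : (0 : ℝ) < (m.factorial : ℝ) := by exact_mod_cast m.factorial_pos
  have hepos := Real.exp_pos 1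
  -- the local lemma gives a large neighbourhood
  have hbig : (m.factorial : ℝ) < Real.exp 1 * (d + 1) := by
    by_contra hcon
    push Not at hcon
    obtain ⟨x, hx0, hx1, hpx⟩ := lll_param d (1 / (m.factorial : ℝ)) (by
      rw [mul_one_div, div_mul_eq_mul_div, div_le_one hfpos]; exact hcon)
    have : Nonempty (V ≃ Fin (Fintype.card V)) := ⟨Fintype.equivFin V⟩
    obtain ⟨σ, hσ⟩ := lll_aux (Ω := V ≃ Fin (Fintype.card V))
      (fun e σ => StrictMono (σ ∘ g e)) Γ E d _ x hx0 hx1 hpx hmax₀ (by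
        intro e he S hS hSΓ
        have h := order_indep (n := Fintype.card V) (g e) (hginj e he)
          (fun σ => ∀ f ∈ S, ¬ StrictMono (σ ∘ g f)) (by
            intro σ τ hστ h f hf hmono
            apply h f hf
            have : σ ∘ g f = τ ∘ g f := by
              funext i
              apply hστ
              intro hv
              apply (hSΓ f hf).1
              simp only [hΓ, Finset.mem_filter]
              exact ⟨hS hf, (hSΓ f hf).2, g f i, hv, i, rfl⟩
            rw [this]; exact hmono)
        rw [one_div, inv_mul_eq_div, le_div_iff₀ hfpos]
        norm_cast
        convert h)
    obtain ⟨e, he, hcons⟩ := hO (fun v => (σ v : ℕ)) (Fin.val_injective.comp σ.injective)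
    apply hσ e he
    intro i j hij
    exact hcons _ _ (Fin.strictMono_succAbove _ hij)
  -- a vertex of large degree in the truncated graph
  set D : V → Finset (Fin (m + 1) → V) := fun v => E.filter fun f => v ∈ Set.range (g f) with hD
  obtain ⟨i₀, hi₀⟩ : ∃ i : Fin m, d + m ≤ m * (D (g e₀ i)).card := by
    by_contra hcon
    push Not at hcon
    have hsub : Γ e₀ ⊆ Finset.univ.biUnion fun i : Fin m => (D (g e₀ i)).erase e₀ := by
      intro f hf
      simp only [hΓ, Finset.mem_filter] at hf
      obtain ⟨hfE, hne, v, ⟨i, rfl⟩, hv⟩ := hf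
      simp only [Finset.mem_biUnion, Finset.mem_univ, true_and, Finset.mem_erase, hD,
        Finset.mem_filter]
      exact ⟨i, hne, hfE, hv⟩
    have h1 := (Finset.card_le_card hsub).trans Finset.card_biUnion_le
    have h2 : ∀ i : Fin m, ((D (g e₀ i)).erase e₀).card + 1 = (D (g e₀ i)).card := by
      intro i
      apply Finset.card_erase_add_one
      simp only [hD, Finset.mem_filter]
      exact ⟨he₀, i, rfl⟩
    have h3 : ∀ i ∈ (Finset.univ : Finset (Fin m)),
        m * ((D (g e₀ i)).erase e₀).card < d := by
      intro i _
      have := hcon i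
      rw [← h2 i] at this
      nlinarith
    have : Nonempty (Fin m) := ⟨⟨0, hm⟩⟩
    have h4 := Finset.sum_lt_sum_of_nonempty Finset.univ_nonempty h3
    rw [← Finset.mul_sum, Finset.sum_const, Finset.card_univ, Fintype.card_fin,
      smul_eq_mul] at h4
    have h5 := lt_of_mul_lt_mul_left h4 (Nat.zero_le _)
    omega
  set v₀ := g e₀ i₀ with hv₀
  set t := (D v₀).card with ht
  -- the removed vertices
  have hane : ∀ f ∈ E, ∀ v ∈ Set.range (g f), f (a f) ≠ v := by
    rintro f hf _ ⟨i, rfl⟩ h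
    exact Fin.succAbove_ne _ _ ((hinj f hf) h).symm
  set W := (D v₀).image fun f => f (a f) with hW
  have hWcard : W.card = t := by
    apply Finset.card_image_of_injOn
    intro f hf f' hf' hff
    simp only [hD, Finset.coe_filter, Set.mem_ofPred_eq] at hf hf'
    by_contra hne
    refine hane f hf.1 v₀ hf.2 ?_
    refine hlin f hf.1 f' hf'.1 hne ⟨⟨_, rfl⟩, ⟨a f', hff.symm⟩⟩ ⟨hgr _ hf.2, hgr _ hf'.2⟩
  have hWdeg : ∀ w ∈ W, t ≤ (E.filter fun e => w ∈ Set.range e).card := by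
    intro w hw
    obtain ⟨f, hf, rfl⟩ := Finset.mem_image.mp hw
    simp only [hD, Finset.mem_filter] at hf
    obtain ⟨j, hj⟩ := hgr _ hf.2
    have h1 : deg v₀ ≤ deg (f (a f)) := by rw [← hj]; exact ha f j
    refine le_trans ?_ h1
    apply Finset.card_le_card
    intro f' hf'
    simp only [hD, Finset.mem_filter] at hf' ⊢
    exact ⟨hf'.1, hgr _ hf'.2⟩
  have hmany := many_edges' E (fun v (e : Fin (m + 1) → V) => v ∈ Set.range e) t (by
    intro e he f hf hne v w h1 h2 h3 h4
    exact hlin e he f hf hne ⟨h1, h2⟩ ⟨h3, h4⟩) W (by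
      intro w hw; convert hWdeg w hw)
  rw [hWcard] at hmany
  have hle : t * t ≤ E.card + t.choose 2 :=
    hmany
  have hle2 : (t : ℝ) * t ≤ 2 * E.card := by
    have h1 : (t : ℝ) * t ≤ E.card + t * (t - 1) / 2 := by
      rw [← Nat.cast_choose_two ℝ t]; exact_mod_cast hle
    have : (0 : ℝ) ≤ t := Nat.cast_nonneg _
    nlinarith
  -- conclusion
  have hi₀' : (d : ℝ) + m ≤ m * t := by exact_mod_cast hi₀
  have hm' : (1 : ℝ) ≤ m := by exact_mod_cast hm
  have hmt : (m.factorial : ℝ) ≤ Real.exp 1 * (m * t) :=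
    hbig.le.trans (mul_le_mul_of_nonneg_left (by linarith) hepos.le)
  have ht0 : (0 : ℝ) ≤ t := Nat.cast_nonneg _
  have hkf : ((m + 1).factorial : ℝ) ≤ Real.exp 1 * ((m + 1 : ℕ) : ℝ) ^ 2 * t := by
    rw [Nat.factorial_succ]
    push_cast
    calc ((m : ℝ) + 1) * m.factorial ≤ (m + 1) * (Real.exp 1 * (m * t)) :=
          mul_le_mul_of_nonneg_left hmt (by positivity)
      _ ≤ (m + 1) * (Real.exp 1 * ((m + 1) * t)) := by gcongr; linarith
      _ = _ := by ring
  rw [div_le_iff₀ (by positivity)]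
  calc ((m + 1).factorial : ℝ) ^ 2 ≤ (Real.exp 1 * ((m + 1 : ℕ) : ℝ) ^ 2 * t) ^ 2 := by gcongr
    _ = (Real.exp 1 ^ 2 * ((m + 1 : ℕ) : ℝ) ^ 4) * (t * t) := by ring
    _ ≤ (Real.exp 1 ^ 2 * ((m + 1 : ℕ) : ℝ) ^ 4) * (2 * E.card) := by gcongr
    _ = _ := by ring
end

section
/- For every integer k ≥ 2, every linear k-graph with the weak Erdős–Szekeres property has at least (k!)²/(8e²k⁴) edges; that is, f'_wES(k) ≥ (k!)²/(8e²k⁴). -/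
open scoped Classical

namespace WES

/-- The elements of `Ω` avoiding all the events in `S`. -/
noncomputable def good {Ω I : Type*} [Fintype Ω] (B : I → Ω → Prop) (S : Finset I) : Finset Ω :=
  Finset.univ.filter (fun w => ∀ j ∈ S, ¬ B j w)

lemma inv_exp_le (D : ℕ) (hD : 2 ≤ D) :
    1 ≤ Real.exp 1 * (1 - 1 / (D : ℝ)) ^ (D - 1) := by
  obtain ⟨n, rfl⟩ : ∃ n, D = n + 1 := ⟨D - 1, by omega⟩
  have hn : (0 : ℝ) < n := by
    have : 0 < n := by omega
    exact_mod_cast this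
  have h1 : (1 + 1 / (n : ℝ)) ^ n ≤ Real.exp 1 := by
    have h := Real.add_one_le_exp (1 / (n : ℝ))
    calc (1 + 1 / (n : ℝ)) ^ n ≤ (Real.exp (1 / (n : ℝ))) ^ n := by
          gcongr; linarith
      _ = Real.exp 1 := by
          rw [← Real.exp_nat_mul]; congr 1; field_simp
  have h2 : (1 + 1 / (n : ℝ)) * (1 - 1 / ((n + 1 : ℕ) : ℝ)) = 1 := by
    push_cast; field_simp; ring
  have h0 : 0 ≤ 1 - 1 / ((n + 1 : ℕ) : ℝ) := by
    push_cast
    have : 1 / ((n : ℝ) + 1) ≤ 1 := by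
      rw [div_le_one (by positivity)]; linarith
    linarith
  calc (1 : ℝ) = ((1 + 1 / (n : ℝ)) * (1 - 1 / ((n + 1 : ℕ) : ℝ))) ^ n := by rw [h2, one_pow]
    _ = (1 + 1 / (n : ℝ)) ^ n * (1 - 1 / ((n + 1 : ℕ) : ℝ)) ^ n := mul_pow _ _ _
    _ ≤ _ := by
      simp only [Nat.add_sub_cancel]
      gcongr

/-- Finite symmetric (lopsided) local lemma. -/
lemma local_lemma {Ω I : Type*} [Fintype Ω] [Nonempty Ω] (B : I → Ω → Prop) (E : Finset I)
    (G : I → Finset I) (D : ℕ) (hD : 2 ≤ D) (p : ℝ) (hp0 : 0 ≤ p)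
    (hp : Real.exp 1 * p * D ≤ 1)
    (hG : ∀ i ∈ E, (G i).card ≤ D) (hself : ∀ i ∈ E, i ∈ G i)
    (hB : ∀ i ∈ E, ∀ S ⊆ E, (∀ j ∈ S, j ∉ G i) →
      (((good B S).filter (fun w => B i w)).card : ℝ) ≤ p * (good B S).card) :
    ∃ w, ∀ i ∈ E, ¬ B i w := by
  have hDpos : (0 : ℝ) < D := by
    have : 0 < D := by omega
    exact_mod_cast this
  set x : ℝ := 1 / D with hx
  have hx1 : 0 < 1 - x := by
    have : x < 1 := by
      rw [hx, div_lt_one hDpos]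
      have : 1 < D := by omega
      exact_mod_cast this
    linarith
  have hx2 : 1 - x ≤ 1 := by
    have : 0 ≤ x := by rw [hx]; positivity
    linarith
  have hpx : Real.exp 1 * p ≤ x := by
    rw [hx, le_div_iff₀ hDpos]; exact hp
  have split : ∀ (S : Finset I) (i : I),
      (good B S).card = (good B (insert i S)).card + ((good B S).filter (fun w => B i w)).card := by
    intro S i
    rw [← Finset.card_filter_add_card_filter_not (s := good B S) (fun w => B i w), add_comm]
    congr 2
    ext w
    simp only [good, Finset.mem_filter, Finset.mem_univ, true_and, Finset.mem_insert,
      forall_eq_or_imp]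
    tauto
  have mono : ∀ (S T : Finset I), S ⊆ T → good B T ⊆ good B S := by
    intro S T h w
    simp only [good, Finset.mem_filter, Finset.mem_univ, true_and]
    intro hw j hj
    exact hw j (h hj)
  have key : ∀ n : ℕ, ∀ S ⊆ E, S.card = n → ∀ i ∈ E, i ∉ S →
      (1 - x) * ((good B S).card : ℝ) ≤ (good B (insert i S)).card := by
    intro n
    induction n using Nat.strong_induction_on with
    | _ n ih =>
      intro S hS hSn i hi hiS
      set S2 := S.filter (fun j => j ∉ G i) with hS2
      have chain : ∀ T : Finset I, T ⊆ S.filter (fun j => j ∈ G i) →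
          (1 - x) ^ T.card * ((good B S2).card : ℝ) ≤ (good B (T ∪ S2)).card := by
        intro T
        induction T using Finset.induction_on with
        | empty => intro _; simp
        | insert a T ha ihT =>
          intro hT
          have hT' : T ⊆ S.filter (fun j => j ∈ G i) :=
            (Finset.subset_insert a T).trans hT
          have h1 := ihT hT'
          have ha' := Finset.mem_filter.1 (hT (Finset.mem_insert_self a T))
          have hnot : a ∉ T ∪ S2 := by
            simp only [Finset.mem_union, not_or, hS2, Finset.mem_filter]
            exact ⟨ha, fun h => h.2 ha'.2⟩
          have hsub : T ∪ S2 ⊆ S :=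
            Finset.union_subset (hT'.trans (Finset.filter_subset _ _)) (Finset.filter_subset _ _)
          have hlt : (T ∪ S2).card < n := by
            rw [← hSn]
            apply Finset.card_lt_card
            exact ⟨hsub, fun h => hnot (h ha'.1)⟩
          have h2 := ih _ hlt (T ∪ S2) (hsub.trans hS) rfl a (hS ha'.1) hnot
          rw [Finset.card_insert_of_notMem ha, Finset.insert_union]
          calc (1 - x) ^ (T.card + 1) * ((good B S2).card : ℝ)
              = (1 - x) * ((1 - x) ^ T.card * ((good B S2).card : ℝ)) := by ring
            _ ≤ (1 - x) * ((good B (T ∪ S2)).card : ℝ) := by gcongr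
            _ ≤ _ := h2
      have hc := chain _ (le_refl _)
      have hun : S.filter (fun j => j ∈ G i) ∪ S2 = S := by
        rw [hS2, Finset.filter_union_filter_not_eq]
      rw [hun] at hc
      have hcard : (S.filter (fun j => j ∈ G i)).card ≤ D - 1 := by
        have h1 : S.filter (fun j => j ∈ G i) ⊆ (G i).erase i := by
          intro j hj
          rw [Finset.mem_filter] at hj
          rw [Finset.mem_erase]
          exact ⟨fun h => hiS (h ▸ hj.1), hj.2⟩
        have h2 := Finset.card_le_card h1
        rw [Finset.card_erase_of_mem (hself i hi)] at h2
        have := hG i hi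
        omega
      have hpow : (1 - x) ^ (D - 1) ≤ (1 - x) ^ (S.filter (fun j => j ∈ G i)).card :=
        pow_le_pow_of_le_one hx1.le hx2 hcard
      have hN : ((good B S2).card : ℝ) ≤ Real.exp 1 * (good B S).card := by
        have h3 := inv_exp_le D hD
        calc ((good B S2).card : ℝ) = 1 * ((good B S2).card : ℝ) := by ring
          _ ≤ (Real.exp 1 * (1 - x) ^ (D - 1)) * ((good B S2).card : ℝ) := by gcongr
          _ = Real.exp 1 * ((1 - x) ^ (D - 1) * ((good B S2).card : ℝ)) := by ring
          _ ≤ Real.exp 1 * ((1 - x) ^ (S.filter (fun j => j ∈ G i)).card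
                * ((good B S2).card : ℝ)) := by gcongr
          _ ≤ _ := by gcongr
      have hb := hB i hi S2 ((Finset.filter_subset _ _).trans hS)
        (fun j hj => (Finset.mem_filter.1 hj).2)
      have hb2 : (((good B S).filter (fun w => B i w)).card : ℝ)
          ≤ ((good B S2).filter (fun w => B i w)).card := by
        exact_mod_cast Finset.card_le_card
          (Finset.filter_subset_filter _ (mono _ _ (Finset.filter_subset _ _)))
      have hs : ((good B S).card : ℝ) = (good B (insert i S)).card
          + ((good B S).filter (fun w => B i w)).card := by
        exact_mod_cast split S i
      have hfin : (((good B S).filter (fun w => B i w)).card : ℝ) ≤ x * (good B S).card := by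
        calc (((good B S).filter (fun w => B i w)).card : ℝ) ≤ p * (good B S2).card := hb2.trans hb
          _ ≤ p * (Real.exp 1 * (good B S).card) := by gcongr
          _ = (Real.exp 1 * p) * (good B S).card := by ring
          _ ≤ _ := by gcongr
      linarith
  have fin : ∀ T : Finset I, T ⊆ E → 0 < ((good B T).card : ℝ) := by
    intro T
    induction T using Finset.induction_on with
    | empty =>
      intro _
      simp [good, Fintype.card_pos]
    | insert a T ha ihT =>
      intro hT
      have h1 := ihT ((Finset.subset_insert a T).trans hT)
      have h2 := key _ T ((Finset.subset_insert a T).trans hT) rfl a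
        (hT (Finset.mem_insert_self a T)) ha
      exact lt_of_lt_of_le (mul_pos hx1 h1) h2
  have := fin E (le_refl _)
  have h2 : 0 < (good B E).card := by exact_mod_cast this
  obtain ⟨w, hw⟩ := Finset.card_pos.1 h2
  refine ⟨w, ?_⟩
  simpa [good] using hw

/-- a permutation of a finite set strictly increasing for an injective labelling is trivial. -/
lemma perm_eq_one {α : Type*} [Finite α] (s : α → ℕ) (hs : Function.Injective s)
    (r : Equiv.Perm α) (h : ∀ x y, s x < s y → s (r x) < s (r y)) : r = 1 := by
  let _ : LinearOrder α := LinearOrder.lift' s hs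
  have hm : StrictMono r := fun x y hxy => h x y hxy
  let f : α ≃o α := StrictMono.orderIsoOfSurjective r hm r.surjective
  have : f = OrderIso.refl α := Subsingleton.elim _ _
  ext x
  exact congrArg (fun g : α ≃o α => g x) this

lemma count_inc {V : Type*} [Fintype V] (s : V → ℕ) (hs : Function.Injective s) (t : V → ℤ)
    (e : Finset V) (A : Finset (Equiv.Perm V))
    (hA : ∀ w ∈ A, ∀ r : Equiv.Perm e, w * Equiv.Perm.ofSubtype r ∈ A) :
    (A.filter (fun w => ∀ x ∈ e, ∀ y ∈ e, s x < s y → t (w x) < t (w y))).card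
      * Nat.factorial e.card ≤ A.card := by
  have hperm : (Finset.univ : Finset (Equiv.Perm e)).card = Nat.factorial e.card := by
    rw [Finset.card_univ, Fintype.card_perm, Fintype.card_coe]
  rw [← hperm, ← Finset.card_product]
  apply Finset.card_le_card_of_injOn
    (fun q : Equiv.Perm V × Equiv.Perm e => q.1 * Equiv.Perm.ofSubtype q.2)
  · intro q hq
    have hq' := Finset.mem_product.1 hq
    exact hA _ (Finset.mem_filter.1 hq'.1).1 _
  · rintro ⟨w, r⟩ hq ⟨w', r'⟩ hq' heq
    have h1 := (Finset.mem_filter.1 (Finset.mem_product.1 hq).1).2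
    have h2 := (Finset.mem_filter.1 (Finset.mem_product.1 hq').1).2
    simp only at h1 h2 heq
    have hw : w' = w * Equiv.Perm.ofSubtype (r * r'⁻¹) := by
      rw [map_mul, map_inv, ← mul_assoc, heq]; group
    have hone : r * r'⁻¹ = 1 := by
      apply perm_eq_one (fun x : e => s x) (fun x y h => Subtype.ext (hs h))
      intro x y hxy
      have h3 := h2 x x.2 y y.2 hxy
      rw [hw] at h3
      simp only [Equiv.Perm.mul_apply, Equiv.Perm.ofSubtype_apply_coe] at h3
      rw [← Equiv.Perm.mul_apply, ← Equiv.Perm.mul_apply] at h3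
      by_contra hcon
      rcases lt_or_eq_of_le (not_lt.1 hcon) with h4 | h4
      · have := h1 _ ((r * r'⁻¹) y).2 _ ((r * r'⁻¹) x).2 h4
        exact absurd this (not_lt.2 h3.le)
      · rw [hs h4] at h3
        exact absurd h3 (lt_irrefl _)
    rw [hone, map_one, mul_one] at hw
    have hr : r = r' := by
      rw [← mul_inv_eq_one]; exact hone
    rw [hw, hr]

/-- the bad event -/
def Bad {V : Type*} (s : V → ℕ) (e : Finset V) (w : Equiv.Perm V) : Prop :=
  (∀ x ∈ e, ∀ y ∈ e, s x < s y → s (w x) < s (w y)) ∨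
  (∀ x ∈ e, ∀ y ∈ e, s x < s y → s (w y) < s (w x))

lemma count_bad {V : Type*} [Fintype V] (s : V → ℕ) (hs : Function.Injective s)
    (e : Finset V) (A : Finset (Equiv.Perm V))
    (hA : ∀ w ∈ A, ∀ r : Equiv.Perm e, w * Equiv.Perm.ofSubtype r ∈ A) :
    (A.filter (fun w => Bad s e w)).card * Nat.factorial e.card ≤ 2 * A.card := by
  have h1 := count_inc s hs (fun v => (s v : ℤ)) e A hA
  have h2 := count_inc s hs (fun v => -(s v : ℤ)) e A hA
  have h3 : (A.filter (fun w => Bad s e w)).card ≤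
      (A.filter (fun w => ∀ x ∈ e, ∀ y ∈ e, s x < s y → (s (w x) : ℤ) < s (w y))).card +
      (A.filter (fun w => ∀ x ∈ e, ∀ y ∈ e, s x < s y → -(s (w x) : ℤ) < -(s (w y) : ℤ))).card := by
    refine le_trans (Finset.card_le_card ?_) (Finset.card_union_le _ _)
    intro w hw
    obtain ⟨hwA, hw⟩ := Finset.mem_filter.1 hw
    simp only [Finset.mem_filter, Finset.mem_union, neg_lt_neg_iff, Nat.cast_lt]
    rcases hw with hw | hw
    · exact Or.inl ⟨hwA, hw⟩
    · exact Or.inr ⟨hwA, hw⟩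
  calc _ ≤ _ := Nat.mul_le_mul_right _ h3
    _ ≤ _ := by rw [add_mul]; omega

lemma core {V : Type*} [Fintype V] (s : V → ℕ) (hs : Function.Injective s)
    (E : Finset (Finset V)) (g : Finset V → Finset V) (m D : ℕ) (hm : 2 ≤ m) (hD : 1 ≤ D)
    (hg : ∀ e ∈ E, (g e).card = m)
    (hdeg : ∀ v, (E.filter (fun e => v ∈ g e)).card ≤ D)
    (hb : 2 * Real.exp 1 * (m * D) ≤ (Nat.factorial m : ℝ)) :
    ∃ w : Equiv.Perm V, ∀ e ∈ E, ¬ Bad s (g e) w := by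
  have hf : (0 : ℝ) < Nat.factorial m := by exact_mod_cast Nat.factorial_pos m
  apply local_lemma (fun e w => Bad s (g e) w) E
    (fun e => E.filter (fun f => ¬ Disjoint (g e) (g f))) (m * D)
    (le_trans hm (Nat.le_mul_of_pos_right m hD)) (2 / Nat.factorial m) (by positivity)
  · rw [← mul_div_assoc, div_mul_eq_mul_div, div_le_one hf]
    push_cast
    linarith
  · intro e he
    have h1 : E.filter (fun f => ¬ Disjoint (g e) (g f)) ⊆
        (g e).biUnion (fun v => E.filter (fun f => v ∈ g f)) := by
      intro f hf
      rw [Finset.mem_filter, Finset.not_disjoint_iff] at hf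
      obtain ⟨hf, v, hv, hv'⟩ := hf
      rw [Finset.mem_biUnion]
      exact ⟨v, hv, Finset.mem_filter.2 ⟨hf, hv'⟩⟩
    rw [← hg e he]
    exact (Finset.card_le_card h1).trans (Finset.card_biUnion_le_card_mul _ _ _ fun v _ => hdeg v)
  · intro e he
    rw [Finset.mem_filter]
    refine ⟨he, ?_⟩
    rw [disjoint_self]
    intro h
    have := hg e he
    rw [h] at this
    simp at this
    omega
  · intro e he S hS hdis
    have h := count_bad s hs (g e) (good (fun e w => Bad s (g e) w) S) ?_
    · rw [hg e he] at h
      have h' : (((good (fun e w => Bad s (g e) w) S).filter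
        (fun w => Bad s (g e) w)).card : ℝ) * Nat.factorial m ≤
          2 * (good (fun e w => Bad s (g e) w) S).card := by exact_mod_cast h
      rw [div_mul_eq_mul_div, le_div_iff₀ hf]
      exact h'
    · intro w hw r
      simp only [good, Finset.mem_filter, Finset.mem_univ, true_and] at hw ⊢
      intro f hfS
      have hd : Disjoint (g e) (g f) := by
        have := hdis f hfS
        rw [Finset.mem_filter] at this
        by_contra hcon
        exact this ⟨hS hfS, hcon⟩
      have hfix : ∀ x ∈ g f, (w * Equiv.Perm.ofSubtype r) x = w x := by
        intro x hx
        rw [Equiv.Perm.mul_apply, Equiv.Perm.ofSubtype_apply_of_not_mem]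
        exact fun hx' => Finset.disjoint_left.1 hd hx' hx
      intro hbad
      apply hw f hfS
      rcases hbad with hbad | hbad
      · left
        intro x hx y hy hxy
        have := hbad x hx y hy hxy
        rwa [hfix x hx, hfix y hy] at this
      · right
        intro x hx y hy hxy
        have := hbad x hx y hy hxy
        rwa [hfix x hx, hfix y hy] at this

lemma many_edges {V : Type*} (E : Finset (Finset V))
    (hlin : ∀ e ∈ E, ∀ f ∈ E, e ≠ f → (e ∩ f).card ≤ 1) (D : ℕ) (R : Finset V)
    (hR : ∀ v ∈ R, D ≤ (E.filter (fun e => v ∈ e)).card) :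
    2 * R.card * D ≤ 2 * (R.biUnion (fun v => E.filter (fun e => v ∈ e))).card + R.card ^ 2 := by
  induction R using Finset.induction_on with
  | empty => simp
  | insert a R ha ih =>
    have h1 := ih (fun v hv => hR v (Finset.mem_insert_of_mem hv))
    have h2 := hR a (Finset.mem_insert_self a R)
    rw [Finset.card_insert_of_notMem ha, Finset.biUnion_insert]
    set U := R.biUnion (fun v => E.filter (fun e => v ∈ e)) with hU
    set F := E.filter (fun e => a ∈ e) with hF
    have h3 := Finset.card_union_add_card_inter F U
    have h4 : (F ∩ U).card ≤ R.card := by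
      have hsub : F ∩ U ⊆ R.biUnion (fun v => E.filter (fun e => a ∈ e ∧ v ∈ e)) := by
        intro e he
        simp only [hF, hU, Finset.mem_inter, Finset.mem_filter, Finset.mem_biUnion] at he ⊢
        obtain ⟨⟨h, h'⟩, v, hv, _, hve⟩ := he
        exact ⟨v, hv, h, h', hve⟩
      refine (Finset.card_le_card hsub).trans ?_
      have := Finset.card_biUnion_le_card_mul R (fun v => E.filter (fun e => a ∈ e ∧ v ∈ e)) 1 ?_
      · simpa using this
      · intro v hv
        rw [Finset.card_le_one]
        intro e he f hf
        rw [Finset.mem_filter] at he hf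
        by_contra hne
        have h5 := hlin e he.1 f hf.1 hne
        rw [Finset.card_le_one] at h5
        have := h5 a (Finset.mem_inter.2 ⟨he.2.1, hf.2.1⟩) v (Finset.mem_inter.2 ⟨he.2.2, hf.2.2⟩)
        exact ha (this ▸ hv)
    nlinarith

end WES

/-- For every integer `k ≥ 2`, every linear `k`-graph with the weak
Erdős–Szekeres property has at least `(k!)²/(8e²k⁴)` edges; that is,
`f'_wES(k) ≥ (k!)²/(8e²k⁴)`. -/
theorem stmt_6 (k : ℕ) (hk : 2 ≤ k) (V : Type*) [Fintype V]
    (E : Finset (Finset V))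
    (hcard : ∀ e ∈ E, e.card = k)
    (hlin : ∀ e ∈ E, ∀ f ∈ E, e ≠ f → (e ∩ f).card ≤ 1)
    (hwES : ∃ σ : V → ℕ, Function.Injective σ ∧
      ∀ τ : V → ℕ, Function.Injective τ →
        ∃ e ∈ E, (∀ x ∈ e, ∀ y ∈ e, σ x < σ y → τ x < τ y) ∨
                 (∀ x ∈ e, ∀ y ∈ e, σ x < σ y → τ y < τ x)) :
    ((Nat.factorial k : ℝ)) ^ 2 / (8 * Real.exp 1 ^ 2 * (k : ℝ) ^ 4) ≤ E.card := by
  obtain ⟨s, hs, hwES⟩ := hwES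
  obtain ⟨e₀, he₀, -⟩ := hwES s hs
  have hE1 : (1 : ℝ) ≤ E.card := by
    exact_mod_cast Finset.card_pos.2 ⟨e₀, he₀⟩
  have hexp : (1 : ℝ) ≤ Real.exp 1 := Real.one_le_exp (by norm_num)
  rcases Nat.eq_or_lt_of_le hk with rfl | hk3
  · refine le_trans ?_ hE1
    rw [div_le_one (by positivity)]
    have h2 : (1 : ℝ) ≤ Real.exp 1 ^ 2 := one_le_pow₀ hexp
    have h3 : ((Nat.factorial 2 : ℕ) : ℝ) = 2 := by norm_num [Nat.factorial]
    rw [h3]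
    push_cast
    linarith
  obtain ⟨m, rfl⟩ : ∃ m, k = m + 1 := ⟨k - 1, by omega⟩
  have hm : 2 ≤ m := by omega
  -- choose a vertex of maximal degree in each edge
  have hr : ∀ e : Finset V, ∃ v, e ∈ E → v ∈ e ∧ ∀ u ∈ e,
      (E.filter (fun f => u ∈ f)).card ≤ (E.filter (fun f => v ∈ f)).card := by
    have hne : ∀ e ∈ E, e.Nonempty := by
      intro e he
      rw [← Finset.card_pos, hcard e he]; omega
    intro e
    by_cases he : e ∈ E
    · obtain ⟨v, hv, hv'⟩ := Finset.exists_max_image e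
        (fun u => (E.filter (fun f => u ∈ f)).card) (hne e he)
      exact ⟨v, fun _ => ⟨hv, hv'⟩⟩
    · obtain ⟨v, _⟩ := hne e₀ he₀
      exact ⟨v, fun h => absurd h he⟩
  choose r hr using hr
  have hg : ∀ e ∈ E, (e.erase (r e)).card = m := by
    intro e he
    rw [Finset.card_erase_of_mem (hr e he).1, hcard e he]; rfl
  obtain ⟨v₀, hv₀⟩ : (e₀.erase (r e₀)).Nonempty := by
    rw [← Finset.card_pos, hg e₀ he₀]; omega
  obtain ⟨v, -, hv⟩ := Finset.exists_max_image (Finset.univ : Finset V)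
    (fun u => (E.filter (fun e : Finset V => u ∈ e.erase (r e))).card) ⟨v₀, Finset.mem_univ _⟩
  set F := E.filter (fun e => v ∈ e.erase (r e)) with hF
  have hD : 1 ≤ F.card := by
    refine le_trans ?_ (hv v₀ (Finset.mem_univ _))
    exact Finset.card_pos.2 ⟨e₀, Finset.mem_filter.2 ⟨he₀, hv₀⟩⟩
  have hbig : (Nat.factorial m : ℝ) < 2 * Real.exp 1 * (m * F.card) := by
    by_contra hcon
    obtain ⟨w, hw⟩ := WES.core s hs E (fun e => e.erase (r e)) m F.card hm hD hg
      (fun u => hv u (Finset.mem_univ _)) (not_lt.1 hcon)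
    obtain ⟨e, he, h⟩ := hwES (fun x => s (w x)) (hs.comp w.injective)
    apply hw e he
    rcases h with h | h
    · left
      intro x hx y hy
      exact h x (Finset.mem_of_mem_erase hx) y (Finset.mem_of_mem_erase hy)
    · right
      intro x hx y hy
      exact h x (Finset.mem_of_mem_erase hx) y (Finset.mem_of_mem_erase hy)
  have hinj : Set.InjOn r F := by
    intro e he f hf hef
    have he' := Finset.mem_filter.1 (Finset.mem_coe.1 he)
    have hf' := Finset.mem_filter.1 (Finset.mem_coe.1 hf)
    by_contra hne
    have h1 := hlin e he'.1 f hf'.1 hne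
    rw [Finset.card_le_one] at h1
    have hve := Finset.mem_erase.1 he'.2
    have hvf := Finset.mem_erase.1 hf'.2
    apply hve.1
    apply h1 v (Finset.mem_inter.2 ⟨hve.2, hvf.2⟩) (r e)
    refine Finset.mem_inter.2 ⟨(hr e he'.1).1, ?_⟩
    rw [hef]
    exact (hr f hf'.1).1
  have hRcard : (F.image r).card = F.card := Finset.card_image_of_injOn hinj
  have hmany := WES.many_edges E hlin F.card (F.image r) (by
    intro u hu
    obtain ⟨e, he, rfl⟩ := Finset.mem_image.1 hu
    have he' := Finset.mem_filter.1 he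
    refine le_trans (Finset.card_le_card ?_)
      ((hr e he'.1).2 v (Finset.mem_of_mem_erase he'.2))
    intro f hf
    have hf' := Finset.mem_filter.1 hf
    exact Finset.mem_filter.2 ⟨hf'.1, Finset.mem_of_mem_erase hf'.2⟩)
  have hsubE : ((F.image r).biUnion (fun v => E.filter (fun e => v ∈ e))).card ≤ E.card := by
    apply Finset.card_le_card
    intro e he
    obtain ⟨_, _, h⟩ := Finset.mem_biUnion.1 he
    exact (Finset.mem_filter.1 h).1
  rw [hRcard] at hmany
  have hfin : F.card ^ 2 ≤ 2 * E.card := by nlinarith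
  have hfin' : (F.card : ℝ) ^ 2 ≤ 2 * E.card := by exact_mod_cast hfin
  rw [div_le_iff₀ (by positivity), Nat.factorial_succ]
  push_cast
  have hmp : (0 : ℝ) ≤ m := Nat.cast_nonneg m
  calc (((m : ℝ) + 1) * (Nat.factorial m : ℝ)) ^ 2
      ≤ (((m : ℝ) + 1) * (2 * Real.exp 1 * ((m + 1) * F.card))) ^ 2 := by
        gcongr
        refine hbig.le.trans ?_
        gcongr
        linarith
    _ = 4 * Real.exp 1 ^ 2 * ((m : ℝ) + 1) ^ 4 * (F.card : ℝ) ^ 2 := by ring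
    _ ≤ 4 * Real.exp 1 ^ 2 * ((m : ℝ) + 1) ^ 4 * (2 * E.card) := by gcongr
    _ = _ := by ring
end

section
/- Let k ≥ 3 and let H be an oriented linear k-graph satisfying Property O. Set Λ = ⌊(k−1)!/(e·k)⌋ + 2, and let S be the set of vertices of H of degree at least Λ (the degree of a vertex is the number of edges containing it). Then |S| ≥ Λ + 1. -/
open scoped Classical

/-- Outcomes avoiding all bad events indexed by `T`. -/
noncomputable def goodSet {Ω ι : Type*} [Fintype Ω] (A : ι → Ω → Prop) (T : Finset ι) : Finset Ω :=
  Finset.univ.filter (fun ω => ∀ j ∈ T, ¬ A j ω)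

lemma goodSet_insert {Ω ι : Type*} [Fintype Ω] (A : ι → Ω → Prop) (T : Finset ι) (j : ι) :
    ((goodSet A (insert j T)).card : ℝ)
      = (goodSet A T).card - ((goodSet A T).filter (fun ω => A j ω)).card := by
  have h := Finset.card_filter_add_card_filter_not (s := goodSet A T) (fun ω => A j ω)
  have h2 : goodSet A (insert j T) = (goodSet A T).filter (fun ω => ¬ A j ω) := by
    ext ω
    simp [goodSet, and_comm]
  rw [h2, ← h]
  push_cast
  ring

/-- Lopsided local lemma, counting form. -/
lemma lll_step {Ω ι : Type*} [Fintype Ω] (A : ι → Ω → Prop) (E : Finset ι)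
    (Γ : ι → Finset ι) (d : ℕ) (p x : ℝ) (hx0 : 0 ≤ x) (hx1 : x < 1)
    (hp : p ≤ x * (1 - x) ^ d)
    (hd : ∀ i ∈ E, (Γ i).card ≤ d)
    (hA : ∀ i ∈ E, ∀ T ⊆ E, i ∉ T → Disjoint T (Γ i) →
      (((goodSet A T).filter (fun ω => A i ω)).card : ℝ) ≤ p * (goodSet A T).card) :
    ∀ n : ℕ, ∀ T ⊆ E, T.card = n → ∀ i ∈ E, i ∉ T →
      (((goodSet A T).filter (fun ω => A i ω)).card : ℝ) ≤ x * (goodSet A T).card := by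
  intro n
  induction n using Nat.strong_induction_on with
  | _ n ih =>
    intro T hT hn i hi hiT
    have key : ∀ U : Finset ι, U ⊆ T → Disjoint U (T \ Γ i) →
        (1 - x) ^ U.card * ((goodSet A (T \ Γ i)).card : ℝ)
          ≤ (goodSet A (U ∪ (T \ Γ i))).card := by
      intro U
      induction U using Finset.induction_on with
      | empty => intro _ _; simp
      | insert j U hj ihU =>
        intro hU hdis
        rw [Finset.disjoint_insert_left] at hdis
        have h1 := ihU (fun a ha => hU (Finset.mem_insert_of_mem ha)) hdis.2
        have hjT : j ∈ T := hU (Finset.mem_insert_self _ _)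
        have hjn : j ∉ U ∪ (T \ Γ i) := by
          rw [Finset.mem_union]; rintro (h | h)
          · exact hj h
          · exact hdis.1 h
        have hsub : U ∪ (T \ Γ i) ⊆ T :=
          Finset.union_subset (fun a ha => hU (Finset.mem_insert_of_mem ha)) Finset.sdiff_subset
        have hlt : (U ∪ (T \ Γ i)).card < n := by
          rw [← hn]
          apply Finset.card_lt_card
          refine ⟨hsub, fun h => hjn (h hjT)⟩
        have h2 := ih _ hlt _ (hsub.trans hT) rfl j (hT hjT) hjn
        rw [Finset.insert_union, goodSet_insert, Finset.card_insert_of_notMem hj, pow_succ]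
        have : 0 < 1 - x := by linarith
        nlinarith
    have h3 := key (T ∩ Γ i) Finset.inter_subset_left (by
      rw [Finset.disjoint_left]; intro a ha hb
      simp at ha hb; exact hb.2 ha.2)
    have hTe : T ∩ Γ i ∪ T \ Γ i = T := by
      ext a; simp; tauto
    rw [hTe] at h3
    have h4 := hA i hi (T \ Γ i) (Finset.sdiff_subset.trans hT)
      (fun h => hiT (Finset.sdiff_subset h)) Finset.sdiff_disjoint
    have h5 : (((goodSet A T).filter (fun ω => A i ω)).card : ℝ)
        ≤ ((goodSet A (T \ Γ i)).filter (fun ω => A i ω)).card := by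
      norm_cast
      apply Finset.card_le_card
      apply Finset.filter_subset_filter
      intro ω
      simp only [goodSet, Finset.mem_filter, Finset.mem_univ, true_and]
      intro h j hj
      exact h j (Finset.sdiff_subset hj)
    have h6 : (1 - x) ^ d ≤ (1 - x) ^ (T ∩ Γ i).card := by
      apply pow_le_pow_of_le_one (by linarith) (by linarith)
      exact (Finset.card_le_card Finset.inter_subset_right).trans (hd i hi)
    have hc : (0 : ℝ) ≤ (goodSet A (T \ Γ i)).card := Nat.cast_nonneg _
    calc _ ≤ _ := h5
      _ ≤ _ := h4
      _ ≤ x * (1 - x) ^ d * (goodSet A (T \ Γ i)).card := by gcongr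
      _ ≤ x * (1 - x) ^ (T ∩ Γ i).card * (goodSet A (T \ Γ i)).card := by gcongr
      _ = x * ((1 - x) ^ (T ∩ Γ i).card * (goodSet A (T \ Γ i)).card) := by ring
      _ ≤ _ := by gcongr

lemma lll {Ω ι : Type*} [Fintype Ω] [Nonempty Ω] (A : ι → Ω → Prop) (E : Finset ι)
    (Γ : ι → Finset ι) (d : ℕ) (p x : ℝ) (hx0 : 0 ≤ x) (hx1 : x < 1)
    (hp : p ≤ x * (1 - x) ^ d)
    (hd : ∀ i ∈ E, (Γ i).card ≤ d)
    (hA : ∀ i ∈ E, ∀ T ⊆ E, i ∉ T → Disjoint T (Γ i) →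
      (((goodSet A T).filter (fun ω => A i ω)).card : ℝ) ≤ p * (goodSet A T).card) :
    ∃ ω, ∀ i ∈ E, ¬ A i ω := by
  have hs := lll_step A E Γ d p x hx0 hx1 hp hd hA
  have key : ∀ U : Finset ι, U ⊆ E → (0 : ℝ) < (goodSet A U).card := by
    intro U
    induction U using Finset.induction_on with
    | empty =>
      intro _
      have : (goodSet A ∅ : Finset Ω) = Finset.univ := by ext; simp [goodSet]
      rw [this, Finset.card_univ]
      exact_mod_cast Fintype.card_pos
    | insert j U hj ihU =>
      intro hU
      have hU' : U ⊆ E := fun a ha => hU (Finset.mem_insert_of_mem ha)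
      have h1 := ihU hU'
      have h2 := hs _ U hU' rfl j (hU (Finset.mem_insert_self _ _)) hj
      rw [goodSet_insert]
      nlinarith
  have h := key E subset_rfl
  have h' : 0 < (goodSet A E).card := by exact_mod_cast h
  obtain ⟨ω, hω⟩ := Finset.card_pos.mp h'
  refine ⟨ω, ?_⟩
  simpa [goodSet] using hω

lemma strictMono_perm_eq {t : ℕ} {W : Type*} [LinearOrder W] (g g' : Fin t → W)
    (hg : StrictMono g) (hg' : StrictMono g') (τ τ' : Equiv.Perm (Fin t))
    (h : ∀ i, g (τ i) = g' (τ' i)) : τ = τ' := by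
  have hr : Set.range g = Set.range g' := by
    ext w
    constructor
    · rintro ⟨i, rfl⟩
      exact ⟨τ' (τ.symm i), by rw [← h]; simp⟩
    · rintro ⟨i, rfl⟩
      exact ⟨τ (τ'.symm i), by rw [h]; simp⟩
  have hgg : g = g' := (hg.range_inj hg').1 hr
  subst hgg
  ext i
  rw [hg.injective (h i)]

/-- Symmetrisation bound. -/
lemma sym_bound {V : Type*} [Fintype V] {n t : ℕ} (f : Fin t → V) (hf : Function.Injective f)
    (B : Finset (V ≃ Fin n))
    (hB : ∀ σ ∈ B, ∀ π : Equiv.Perm V, (∀ v, v ∉ Set.range f → π v = v) → π.trans σ ∈ B) :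
    t.factorial * (B.filter (fun σ => StrictMono (fun i => σ (f i)))).card ≤ B.card := by
  let ext' : Equiv.Perm (Fin t) → Equiv.Perm V := fun τ =>
    τ.extendDomain (Equiv.ofInjective f hf)
  have e1 : ∀ τ i, ext' τ (f i) = f (τ i) := by
    intro τ i
    have := Equiv.Perm.extendDomain_apply_image τ (Equiv.ofInjective f hf) i
    simpa [ext'] using this
  have e2 : ∀ τ v, v ∉ Set.range f → ext' τ v = v := by
    intro τ v hv
    exact Equiv.Perm.extendDomain_apply_not_subtype τ (Equiv.ofInjective f hf) hv
  have hcard : (Finset.univ : Finset (Equiv.Perm (Fin t))).card = t.factorial := by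
    rw [Finset.card_univ, Fintype.card_perm, Fintype.card_fin]
  rw [← hcard, ← Finset.card_product]
  apply Finset.card_le_card_of_injOn (fun q => (ext' q.1).trans q.2)
  · rintro ⟨τ, σ⟩ hq
    simp only [Finset.coe_product, Set.mem_prod, Finset.mem_coe, Finset.mem_filter] at hq
    exact hB σ hq.2.1 _ (e2 τ)
  · rintro ⟨τ, σ⟩ hq ⟨τ', σ'⟩ hq' heq
    simp only [Finset.coe_product, Set.mem_prod, Finset.mem_coe, Finset.mem_filter] at hq hq'
    have heq' : (ext' τ).trans σ = (ext' τ').trans σ' := heq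
    have hτ : τ = τ' := by
      apply strictMono_perm_eq _ _ hq.2.2 hq'.2.2
      intro i
      have := congrArg (fun s : V ≃ Fin n => s (f i)) heq'
      simpa [e1] using this
    subst hτ
    have : σ = σ' := by
      ext v
      have := congrArg (fun s : V ≃ Fin n => s ((ext' τ).symm v)) heq'
      simp at this
      rw [this]
    rw [this]

lemma numeric (t m : ℕ) (ht : 2 ≤ t)
    (hm : m = ⌊(Nat.factorial t : ℝ) / (Real.exp 1 * ((t + 1 : ℕ) : ℝ))⌋₊) :
    ∃ x : ℝ, 0 ≤ x ∧ x < 1 ∧ 1 / (t.factorial : ℝ) ≤ x * (1 - x) ^ (t * m) := by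
  have hfac : (2 : ℝ) ≤ t.factorial := by
    have := Nat.factorial_le ht
    exact_mod_cast this
  rcases Nat.eq_zero_or_pos m with h0 | hpos
  · refine ⟨1 / 2, by norm_num, by norm_num, ?_⟩
    rw [h0]
    simp only [mul_zero, pow_zero, mul_one]
    exact one_div_le_one_div_of_le (by norm_num) hfac
  · have hd : 0 < t * m := Nat.mul_pos (by omega) hpos
    have hle : (m : ℝ) ≤ (Nat.factorial t : ℝ) / (Real.exp 1 * ((t + 1 : ℕ) : ℝ)) := by
      rw [hm]; exact Nat.floor_le (by positivity)
    have he := Real.exp_pos 1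
    rw [le_div_iff₀ (by positivity)] at hle
    push_cast at hle
    set d := t * m with hdd
    have hdR : (0 : ℝ) < d := by exact_mod_cast hd
    have hm1 : (1 : ℝ) ≤ m := by exact_mod_cast hpos
    have hd1 : ((d : ℝ) + 1) * Real.exp 1 ≤ t.factorial := by
      have : (d : ℝ) = t * m := by rw [hdd]; push_cast; ring
      rw [this]
      nlinarith
    refine ⟨1 / (d + 1), by positivity, ?_, ?_⟩
    · rw [div_lt_one (by positivity)]; linarith
    · have h1 : 1 - 1 / ((d : ℝ) + 1) = (1 + 1 / (d : ℝ))⁻¹ := by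
        field_simp
        ring
      have h2 : (1 + 1 / (d : ℝ)) ^ d ≤ Real.exp 1 := by
        have h3 : 1 + 1 / (d : ℝ) ≤ Real.exp (1 / d) := by
          have := Real.add_one_le_exp (1 / (d : ℝ)); linarith
        calc (1 + 1 / (d : ℝ)) ^ d ≤ Real.exp (1 / d) ^ d := by gcongr
          _ = Real.exp 1 := by
            rw [← Real.exp_nat_mul]; congr 1; field_simp
      rw [h1, inv_pow]
      calc 1 / (t.factorial : ℝ) ≤ 1 / (((d : ℝ) + 1) * Real.exp 1) :=
            one_div_le_one_div_of_le (by positivity) hd1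
        _ = 1 / ((d : ℝ) + 1) * (Real.exp 1)⁻¹ := by field_simp
        _ ≤ _ := by gcongr

/-- Let `k ≥ 3` and let `H` be an oriented linear `k`-graph
satisfying Property O. Set `Λ = ⌊(k−1)!/(e·k)⌋ + 2`, and let `S` be the set of
vertices of `H` of degree at least `Λ` (the degree of a vertex is the number of
edges containing it). Then `|S| ≥ Λ + 1`. -/
theorem stmt_12 (k : ℕ) (hk : 3 ≤ k) (V : Type*) [Fintype V]
    (E : Finset (Fin k → V))
    (hinj : ∀ e ∈ E, Function.Injective e)
    (hdist : ∀ e ∈ E, ∀ f ∈ E, Set.range e = Set.range f → e = f)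
    (hlin : ∀ e ∈ E, ∀ f ∈ E, e ≠ f → (Set.range e ∩ Set.range f).Subsingleton)
    (hO : ∀ σ : V → ℕ, Function.Injective σ →
      ∃ e ∈ E, ∀ i j : Fin k, i < j → σ (e i) < σ (e j))
    (Λ : ℕ)
    (hΛ : Λ = ⌊(Nat.factorial (k - 1) : ℝ) / (Real.exp 1 * (k : ℝ))⌋₊ + 2) :
    Λ + 1 ≤
      (Finset.univ.filter
        (fun v : V => Λ ≤ (E.filter (fun e => ∃ i, e i = v)).card)).card := by
  by_contra hcon
  push Not at hcon
  obtain ⟨t, rfl⟩ : ∃ t, k = t + 1 := ⟨k - 1, by omega⟩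
  simp only [Nat.add_sub_cancel] at hΛ
  obtain ⟨m, hm⟩ : ∃ m, m = ⌊(Nat.factorial t : ℝ) / (Real.exp 1 * ((t + 1 : ℕ) : ℝ))⌋₊ :=
    ⟨_, rfl⟩
  rw [← hm] at hΛ
  obtain ⟨x, hx0, hx1, hp⟩ := numeric t m (by omega) hm
  set S := (Finset.univ.filter
        (fun v : V => Λ ≤ (E.filter (fun e => ∃ i, e i = v)).card)) with hS
  have hc : ∀ f : Fin (t + 1) → V, ∃ c : Fin (t + 1), ∀ i, f i ∈ S → f c ∈ S := by
    intro f
    by_cases h : ∃ i, f i ∈ S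
    · obtain ⟨c, hc⟩ := h
      exact ⟨c, fun _ _ => hc⟩
    · push Not at h
      exact ⟨0, fun i hi => absurd hi (h i)⟩
  choose c hc using hc
  let g : (Fin (t + 1) → V) → Fin t → V := fun f i => f ((c f).succAbove i)
  have hginj : ∀ f ∈ E, Function.Injective (g f) := fun f hf =>
    (hinj f hf).comp Fin.succAbove_right_injective
  -- reduced degree
  have hdeg : ∀ v, (E.filter (fun f => v ∈ Set.range (g f))).card ≤ m + 1 := by
    intro v
    by_cases hv : v ∈ S
    · have hle : (E.filter (fun f => v ∈ Set.range (g f))).card ≤ (S.erase v).card := by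
        apply Finset.card_le_card_of_injOn (fun f => f (c f))
        · intro f hf
          simp only [Finset.coe_filter, Set.mem_ofPred_eq] at hf
          obtain ⟨hfE, i, hi⟩ := hf
          have hi' : f ((c f).succAbove i) = v := hi
          rw [Finset.mem_coe, Finset.mem_erase]
          refine ⟨fun h => ?_, hc f _ (by rw [hi']; exact hv)⟩
          rw [← hi'] at h
          exact Fin.succAbove_ne _ _ (hinj f hfE h).symm
        · intro f hf f' hf' heq
          simp only [Finset.coe_filter, Set.mem_ofPred_eq] at hf hf'
          obtain ⟨hfE, i, hi⟩ := hf
          obtain ⟨hfE', i', hi'⟩ := hf'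
          have heq' : f (c f) = f' (c f') := heq
          by_contra hne
          have h1 : v ∈ Set.range f ∩ Set.range f' := ⟨⟨_, hi⟩, ⟨_, hi'⟩⟩
          have h2 : f (c f) ∈ Set.range f ∩ Set.range f' := ⟨⟨_, rfl⟩, ⟨_, heq'.symm⟩⟩
          have h3 := hlin f hfE f' hfE' hne h1 h2
          rw [← hi] at h3
          exact Fin.succAbove_ne _ _ (hinj f hfE h3)
      rw [Finset.card_erase_of_mem hv] at hle
      omega
    · have hv' : (E.filter (fun e => ∃ i, e i = v)).card < Λ := by
        simpa [hS] using hv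
      have hle : (E.filter (fun f => v ∈ Set.range (g f))).card
          ≤ (E.filter (fun e => ∃ i, e i = v)).card := by
        apply Finset.card_le_card
        intro f hf
        rw [Finset.mem_filter] at hf ⊢
        obtain ⟨hfE, i, hi⟩ := hf
        exact ⟨hfE, _, hi⟩
      omega
  let Γ : (Fin (t + 1) → V) → Finset (Fin (t + 1) → V) := fun e =>
    Finset.univ.biUnion (fun i : Fin t => (E.filter (fun f => g e i ∈ Set.range (g f))).erase e)
  have hΓ : ∀ e ∈ E, (Γ e).card ≤ t * m := by
    intro e he
    have := Finset.card_biUnion_le_card_mul (Finset.univ : Finset (Fin t))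
      (fun i : Fin t => (E.filter (fun f => g e i ∈ Set.range (g f))).erase e) m (by
        intro i _
        rw [Finset.card_erase_of_mem (by
          rw [Finset.mem_filter]; exact ⟨he, i, rfl⟩)]
        have := hdeg (g e i)
        omega)
    simpa [Γ] using this
  let A : (Fin (t + 1) → V) → (V ≃ Fin (Fintype.card V)) → Prop := fun e σ =>
    StrictMono (fun i => σ (g e i))
  have : Nonempty (V ≃ Fin (Fintype.card V)) := ⟨Fintype.equivFin V⟩
  obtain ⟨σ, hσ⟩ := lll A E Γ (t * m) (1 / (t.factorial : ℝ)) x hx0 hx1 hp hΓ (by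
    intro e he T hT heT hdis
    have h := sym_bound (g e) (hginj e he) (goodSet A T) (by
      intro σ hσ π hπ
      simp only [goodSet, Finset.mem_filter, Finset.mem_univ, true_and] at hσ ⊢
      intro f hf hAf
      apply hσ f hf
      have hfix : ∀ i, π (g f i) = g f i := by
        intro i
        apply hπ
        rintro ⟨j, hj⟩
        apply Finset.disjoint_left.mp hdis hf
        simp only [Γ, Finset.mem_biUnion, Finset.mem_univ, true_and]
        refine ⟨j, Finset.mem_erase.mpr ⟨?_, Finset.mem_filter.mpr ⟨hT hf, i, hj.symm⟩⟩⟩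
        rintro rfl
        exact heT hf
      simpa [A, hfix] using hAf)
    have h' : (t.factorial : ℝ) * ((goodSet A T).filter (fun ω => A e ω)).card
        ≤ (goodSet A T).card := by exact_mod_cast h
    have hpos : (0 : ℝ) < t.factorial := by exact_mod_cast t.factorial_pos
    rw [one_div, ← div_eq_inv_mul, le_div_iff₀ hpos, mul_comm]
    refine le_trans (le_of_eq ?_) h'
    congr!)
  obtain ⟨e, he, hmono⟩ := hO (fun v => (σ v : ℕ))
    (fun a b h => σ.injective (Fin.ext h))
  apply hσ e he
  intro i j hij
  exact hmono _ _ (Fin.strictMono_succAbove _ hij)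
end
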